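/- For every irreducible complex character χ of W and every W-orbit C of reflecting hyperplanes, the local Coxeter number c_{χ,C} is a rational integer and satisfies 0 ≤ c_{χ,C} ≤ e_C · ω_C. -/

import Mathlib

open scoped BigOperators

noncomputable section

/-- `χ` is an irreducible complex character of the group `G`. -/
def IsIrredChar (G : Type*) [Group G] (χ : G → ℂ) : Prop :=
  ∃ (n : ℕ) (ρ : Representation ℂ G (Fin n → ℂ)),
    0 < n ∧
    (∀ U : Submodule ℂ (Fin n → ℂ), (∀ g : G, U.map (ρ g) ≤ U) → U = ⊥ ∨ U = ⊤) ∧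
    ∀ g : G, χ g = LinearMap.trace ℂ (Fin n → ℂ) (ρ g)

variable {V : Type*} [AddCommGroup V] [Module ℂ V]

/-- The fixed space `ker (w - id)` of an invertible linear map `w`. -/
def fixedSpace (w : (V →ₗ[ℂ] V)ˣ) : Submodule ℂ V :=
  LinearMap.ker ((w : V →ₗ[ℂ] V) - LinearMap.id)

/-- `w` is a reflection: its fixed space is a hyperplane (codimension 1). -/
def IsReflection (w : (V →ₗ[ℂ] V)ˣ) : Prop :=
  Module.finrank ℂ V = Module.finrank ℂ (fixedSpace w) + 1

/-- The linear map underlying an element of `W`. -/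
def toLin (W : Subgroup (V →ₗ[ℂ] V)ˣ) (w : W) : V →ₗ[ℂ] V :=
  ((w : (V →ₗ[ℂ] V)ˣ) : V →ₗ[ℂ] V)

/-- The set of reflections of `W`. -/
def refls (W : Subgroup (V →ₗ[ℂ] V)ˣ) : Set W :=
  {t | IsReflection (t : (V →ₗ[ℂ] V)ˣ)}

/-- The arrangement of reflecting hyperplanes of `W`. -/
def arrangement (W : Subgroup (V →ₗ[ℂ] V)ˣ) : Set (Submodule ℂ V) :=
  {H | ∃ t : W, t ∈ refls W ∧ H = fixedSpace (t : (V →ₗ[ℂ] V)ˣ)}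

/-- The pointwise stabilizer of a subspace `H` in `W`. -/
def ptStab (W : Subgroup (V →ₗ[ℂ] V)ˣ) (H : Submodule ℂ V) : Set W :=
  {w | ∀ v ∈ H, toLin W w v = v}

/-- The `W`-orbit of a hyperplane `H`. -/
def orbitOf (W : Subgroup (V →ₗ[ℂ] V)ˣ) (H : Submodule ℂ V) : Set (Submodule ℂ V) :=
  {H' | ∃ w : W, H' = H.map (toLin W w)}

/-- The reflections of `W` whose hyperplane lies in the orbit of `H`. -/
def Cref (W : Subgroup (V →ₗ[ℂ] V)ˣ) (H : Submodule ℂ V) : Set W :=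
  {t | t ∈ refls W ∧ fixedSpace (t : (V →ₗ[ℂ] V)ˣ) ∈ orbitOf W H}

/-- `g ∈ W` is a regular element of order `d`: it has a nonzero eigenvector,
with eigenvalue a primitive `d`-th root of unity, lying on no reflecting hyperplane. -/
def IsRegularElt (W : Subgroup (V →ₗ[ℂ] V)ˣ) (g : W) (d : ℕ) : Prop :=
  orderOf g = d ∧ ∃ (ζ : ℂ) (v : V), v ≠ 0 ∧ IsPrimitiveRoot ζ d ∧
    toLin W g v = ζ • v ∧ ∀ H ∈ arrangement W, v ∉ H

/-- The action of `W` on `V` is irreducible. -/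
def IsIrredAction (W : Subgroup (V →ₗ[ℂ] V)ˣ) : Prop :=
  ∀ U : Submodule ℂ V, (∀ w : W, U.map (toLin W w) ≤ U) → U = ⊥ ∨ U = ⊤

/-- `f` is a length-`l` reflection factorization of `g`. -/
def IsReflFac (W : Subgroup (V →ₗ[ℂ] V)ˣ) (g : W) (l : ℕ) (f : Fin l → W) : Prop :=
  (∀ i, f i ∈ refls W) ∧ (List.ofFn f).prod = g

/-- `l` is the reflection length of `g`: the minimal length of a reflection
factorization of `g`. -/
def IsReflLength (W : Subgroup (V →ₗ[ℂ] V)ˣ) (g : W) (l : ℕ) : Prop :=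
  (∃ f : Fin l → W, IsReflFac W g l f) ∧
    ∀ (k : ℕ) (f : Fin k → W), IsReflFac W g k f → l ≤ k

open Classical in
/-- `n` is the minimal number of factors whose hyperplane lies in the orbit `C`,
over all reflection factorizations of `g` (of any length). -/
def IsMinOrbitCount (W : Subgroup (V →ₗ[ℂ] V)ˣ) (g : W)
    (C : Set (Submodule ℂ V)) (n : ℕ) : Prop :=
  (∃ (N : ℕ) (f : Fin N → W), IsReflFac W g N f ∧
      (Finset.univ.filter fun i => fixedSpace (f i : (V →ₗ[ℂ] V)ˣ) ∈ C).card = n) ∧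
  ∀ (N : ℕ) (f : Fin N → W), IsReflFac W g N f →
      n ≤ (Finset.univ.filter fun i => fixedSpace (f i : (V →ₗ[ℂ] V)ˣ) ∈ C).card

lemma aux_integral {G : Type*} [Group G] [Finite G] {n : ℕ} (hn : 0 < n)
    (ρ : Representation ℂ G (Fin n → ℂ))
    (hirr : ∀ U : Submodule ℂ (Fin n → ℂ), (∀ g : G, U.map (ρ g) ≤ U) → U = ⊥ ∨ U = ⊤)
    (s : Finset G) (hs : ∀ g : G, ∀ t ∈ s, g * t * g⁻¹ ∈ s) :
    ∃ c : ℂ, IsIntegral ℤ c ∧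
      ∑ t ∈ s, LinearMap.trace ℂ (Fin n → ℂ) (ρ t) = c * n := by
  have : Nonempty (Fin n) := ⟨⟨0, hn⟩⟩
  set S : Module.End ℂ (Fin n → ℂ) := ∑ t ∈ s, ρ t with hS
  have hcomm : ∀ g : G, ρ g * S = S * ρ g := by
    intro g
    rw [hS, Finset.mul_sum, Finset.sum_mul]
    refine Finset.sum_bij' (fun t _ => g * t * g⁻¹) (fun t _ => g⁻¹ * t * g) ?_ ?_ ?_ ?_ ?_
    · intro t ht; exact hs g t ht
    · intro t ht; simpa using hs g⁻¹ t ht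
    · intro t ht; group
    · intro t ht; group
    · intro t ht
      rw [← map_mul, ← map_mul]
      congr 1
      group
  obtain ⟨c, hc⟩ := Module.End.exists_eigenvalue S
  have htop : Module.End.eigenspace S c = ⊤ := by
    refine (hirr _ ?_).resolve_left hc
    rintro g _ ⟨v, hv, rfl⟩
    have hv' : S v = c • v := Module.End.mem_eigenspace_iff.1 hv
    rw [Module.End.mem_eigenspace_iff]
    have h := LinearMap.congr_fun (hcomm g) v
    simp only [Module.End.mul_apply] at h
    rw [← h, hv', map_smul]
  have hSc : S = algebraMap ℂ (Module.End ℂ (Fin n → ℂ)) c := by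
    ext1 v
    ext1
    have : S (Pi.single v 1) = c • (Pi.single v 1) :=
      Module.End.mem_eigenspace_iff.1 (htop ▸ Submodule.mem_top)
    simpa using this
  refine ⟨c, ?_, ?_⟩
  · have h1 : IsIntegral ℤ (∑ t ∈ s, MonoidAlgebra.of ℤ G t) := IsIntegral.of_finite ℤ _
    have h2 := h1.map (MonoidAlgebra.lift ℤ (Module.End ℂ (Fin n → ℂ)) G ρ)
    rw [map_sum] at h2
    simp only [MonoidAlgebra.lift_of] at h2
    rw [← hS, hSc] at h2
    exact (isIntegral_algebraMap_iff (FaithfulSMul.algebraMap_injective _ _)).1 h2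
  · rw [← map_sum, ← hS, hSc, Algebra.algebraMap_eq_smul_one, map_smul]
    simp

lemma aux_subgroup {G : Type*} [Group G] [Finite G] {n : ℕ}
    (ρ : Representation ℂ G (Fin n → ℂ)) (K : Subgroup G) (s : Finset G)
    (hs : ∀ g, g ∈ s ↔ g ∈ K) :
    ∃ k : ℕ, k ≤ n ∧
      ∑ t ∈ s, LinearMap.trace ℂ (Fin n → ℂ) (ρ t) = (s.card : ℂ) * k := by
  have := Fintype.ofFinite K
  have hcard : Nat.card K = s.card := by
    rw [← Nat.card_eq_finsetCard]
    exact (Nat.card_congr (Equiv.subtypeEquivRight hs)).symm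
  let σ : Representation ℂ K (Fin n → ℂ) := ρ.comp K.subtype
  refine ⟨Module.finrank ℂ σ.invariants, ?_, ?_⟩
  · simpa using Submodule.finrank_le σ.invariants
  · have h : (Nat.card K : ℂ) ≠ 0 := by exact_mod_cast Nat.card_pos.ne'
    have := Invertible.mk _ (inv_mul_cancel₀ h) (mul_inv_cancel₀ h)
    have h2 := Representation.card_inv_mul_sum_char_eq_finrank σ
    rw [← h2, ← hcard, mul_inv_cancel_left₀ h]
    exact (Finset.sum_subtype s hs _)

lemma fixedSpace_eq_top_iff (w : (V →ₗ[ℂ] V)ˣ) : fixedSpace w = ⊤ ↔ w = 1 := by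
  rw [fixedSpace, LinearMap.ker_eq_top, sub_eq_zero]
  exact Units.val_eq_one

lemma mem_fixedSpace (w : (V →ₗ[ℂ] V)ˣ) (v : V) :
    v ∈ fixedSpace w ↔ (w : V →ₗ[ℂ] V) v = v := by
  simp [fixedSpace, sub_eq_zero]

lemma toLin_mul (W : Subgroup (V →ₗ[ℂ] V)ˣ) (a b : W) (v : V) :
    toLin W (a * b) v = toLin W a (toLin W b v) := rfl

lemma toLin_one (W : Subgroup (V →ₗ[ℂ] V)ˣ) (v : V) : toLin W 1 v = v := rfl

lemma toLin_inv_toLin (W : Subgroup (V →ₗ[ℂ] V)ˣ) (a : W) (v : V) :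
    toLin W a⁻¹ (toLin W a v) = v := by
  rw [← toLin_mul, inv_mul_cancel, toLin_one]

lemma toLin_toLin_inv (W : Subgroup (V →ₗ[ℂ] V)ˣ) (a : W) (v : V) :
    toLin W a (toLin W a⁻¹ v) = v := by
  rw [← toLin_mul, mul_inv_cancel, toLin_one]

lemma mem_map_toLin (W : Subgroup (V →ₗ[ℂ] V)ˣ) (a : W) (H : Submodule ℂ V) (v : V) :
    v ∈ H.map (toLin W a) ↔ toLin W a⁻¹ v ∈ H := by
  constructor
  · rintro ⟨u, hu, rfl⟩
    rwa [toLin_inv_toLin]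
  · intro h
    exact ⟨_, h, toLin_toLin_inv W a v⟩

lemma finrank_map_toLin (W : Subgroup (V →ₗ[ℂ] V)ˣ) (a : W) (H : Submodule ℂ V) :
    Module.finrank ℂ (H.map (toLin W a)) = Module.finrank ℂ H := by
  have hinj : Function.Injective (toLin W a) :=
    Function.LeftInverse.injective (toLin_inv_toLin W a)
  exact (Submodule.equivMapOfInjective _ hinj H).finrank_eq.symm

lemma fixedSpace_conj (W : Subgroup (V →ₗ[ℂ] V)ˣ) (a t : W) :
    fixedSpace ((a * t * a⁻¹ : W) : (V →ₗ[ℂ] V)ˣ) =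
      (fixedSpace (t : (V →ₗ[ℂ] V)ˣ)).map (toLin W a) := by
  ext v
  rw [mem_map_toLin, mem_fixedSpace, mem_fixedSpace]
  change toLin W (a * t * a⁻¹) v = v ↔ toLin W t (toLin W a⁻¹ v) = toLin W a⁻¹ v
  rw [toLin_mul, toLin_mul]
  constructor
  · intro h
    conv_rhs => rw [← h]
    rw [toLin_inv_toLin]
  · intro h
    rw [h, toLin_toLin_inv]

lemma Cref_conj (W : Subgroup (V →ₗ[ℂ] V)ˣ) (H : Submodule ℂ V) (a t : W)
    (ht : t ∈ Cref W H) : a * t * a⁻¹ ∈ Cref W H := by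
  obtain ⟨h1, w, hw⟩ := ht
  refine ⟨?_, a * w, ?_⟩
  · change Module.finrank ℂ V = Module.finrank ℂ (fixedSpace _) + 1
    rw [fixedSpace_conj, finrank_map_toLin]
    exact h1
  · rw [fixedSpace_conj, hw, ← Submodule.map_comp]
    rfl

/-- The pointwise stabilizer as a subgroup. -/
def ptStabSubgroup (W : Subgroup (V →ₗ[ℂ] V)ˣ) (H : Submodule ℂ V) : Subgroup W where
  carrier := ptStab W H
  one_mem' := fun v _ => rfl
  mul_mem' := by
    intro a b ha hb v hv
    rw [toLin_mul, hb v hv, ha v hv]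
  inv_mem' := by
    intro a ha v hv
    have h := toLin_inv_toLin W a v
    rwa [ha v hv] at h

lemma ptStab_map_ncard (W : Subgroup (V →ₗ[ℂ] V)ˣ) (H : Submodule ℂ V) (a : W) :
    (ptStab W (H.map (toLin W a))).ncard = (ptStab W H).ncard := by
  have : ptStab W (H.map (toLin W a)) = (MulAut.conj a) '' ptStab W H := by
    ext t
    constructor
    · intro ht
      refine ⟨a⁻¹ * t * a, ?_, by simp [MulAut.conj_apply, mul_assoc]⟩
      intro v hv
      rw [toLin_mul, toLin_mul, ht _ ⟨v, hv, rfl⟩, toLin_inv_toLin]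
    · rintro ⟨u, hu, rfl⟩ _ ⟨v, hv, rfl⟩
      rw [MulAut.conj_apply, toLin_mul, toLin_mul, toLin_inv_toLin, hu v hv]
  rw [this, Set.ncard_image_of_injective _ (MulEquiv.injective _)]


/-- For every irreducible complex character `χ` of `W` and every reflecting
hyperplane `H` (with orbit `C`), the local Coxeter number
`c_{χ,C} = (1/χ(1)) Σ_{t ∈ C^ref} (χ(1) − χ(t))` is a nonnegative rational integer
bounded above by `e_C · ω_C`. -/
theorem local_coxeter_number_integral_and_bounded
    (V : Type*) [AddCommGroup V] [Module ℂ V] [FiniteDimensional ℂ V]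
    (W : Subgroup (V →ₗ[ℂ] V)ˣ) [Finite W]
    (hgen : Subgroup.closure (refls W) = ⊤)
    (χ : W → ℂ) (hχ : IsIrredChar W χ)
    (H : Submodule ℂ V) (hH : H ∈ arrangement W) :
    ∃ m : ℕ, (∑ᶠ t ∈ Cref W H, (χ 1 - χ t)) = (m : ℂ) * χ 1 ∧
      m ≤ (ptStab W H).ncard * (orbitOf W H).ncard := by
  classical
  have := Fintype.ofFinite W
  obtain ⟨n, ρ, hn, hirr, hχρ⟩ := hχ
  have hn0 : (n : ℂ) ≠ 0 := by exact_mod_cast hn.ne'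
  have hχ1 : χ 1 = n := by simp [hχρ]
  have hHrank : Module.finrank ℂ V = Module.finrank ℂ H + 1 := by
    obtain ⟨t, ht, rfl⟩ := hH
    exact ht
  have hOfin : (orbitOf W H).Finite := by
    have : orbitOf W H = Set.range (fun w : W => H.map (toLin W w)) := by
      ext H'; simp [orbitOf, eq_comm]
    rw [this]
    exact Set.finite_range _
  set O : Finset (Submodule ℂ V) := hOfin.toFinset with hO
  set s : Finset W := (Cref W H).toFinset with hs
  set e := (ptStab W H).ncard with he
  have hsum : (∑ᶠ t ∈ Cref W H, (χ 1 - χ t)) = ∑ t ∈ s, (χ 1 - χ t) := by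
    rw [← finsum_mem_coe_finset]
    simp [hs]
  -- fibres
  have hfib : ∀ H' ∈ O, ∃ k : ℕ, k ≤ n ∧
      ∑ t ∈ s.filter (fun t : W => fixedSpace (t : (V →ₗ[ℂ] V)ˣ) = H'), (χ 1 - χ t) = (e : ℂ) * k := by
    intro H' hH'
    have hH'2 : H' ∈ orbitOf W H := by simpa [hO] using hH'
    obtain ⟨w, hw⟩ := id hH'2
    have hrank' : Module.finrank ℂ V = Module.finrank ℂ H' + 1 := by
      rw [hw, finrank_map_toLin]; exact hHrank
    set K : Finset W := (ptStab W H').toFinset with hK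
    have hKcard : K.card = e := by
      rw [hK, ← Set.ncard_eq_toFinset_card', hw, ptStab_map_ncard]
    obtain ⟨k, hk, hks⟩ := aux_subgroup ρ (ptStabSubgroup W H') K
      (fun g => by rw [hK, Set.mem_toFinset]; rfl)
    refine ⟨n - k, Nat.sub_le _ _, ?_⟩
    have hsub : ∑ t ∈ s.filter (fun t : W => fixedSpace (t : (V →ₗ[ℂ] V)ˣ) = H'), (χ 1 - χ t)
        = ∑ t ∈ K, (χ 1 - χ t) := by
      apply Finset.sum_subset
      · intro t ht
        rw [Finset.mem_filter] at ht
        rw [hK, Set.mem_toFinset]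
        intro v hv
        rw [← ht.2, mem_fixedSpace] at hv
        exact hv
      · intro t ht hnt
        rw [hK, Set.mem_toFinset] at ht
        have hle : H' ≤ fixedSpace (t : (V →ₗ[ℂ] V)ˣ) := by
          intro v hv
          rw [mem_fixedSpace]
          exact ht v hv
        by_cases h1 : t = 1
        · rw [h1, sub_self]
        · exfalso
          apply hnt
          have hne : fixedSpace (t : (V →ₗ[ℂ] V)ˣ) ≠ ⊤ := by
            rw [Ne, fixedSpace_eq_top_iff]
            intro h
            exact h1 (Subtype.ext h)
          have hlt := Submodule.finrank_lt (lt_top_iff_ne_top.2 hne).ne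
          have hle2 := Submodule.finrank_mono hle
          have heq : H' = fixedSpace (t : (V →ₗ[ℂ] V)ˣ) :=
            Submodule.eq_of_le_of_finrank_le hle (by omega)
          rw [Finset.mem_filter, hs, Set.mem_toFinset]
          refine ⟨⟨?_, ?_⟩, heq.symm⟩
          · change Module.finrank ℂ V = Module.finrank ℂ (fixedSpace _) + 1
            rw [← heq]; exact hrank'
          · rw [← heq]; exact hH'2
    rw [hsub, Finset.sum_sub_distrib, Finset.sum_const, hχ1]
    simp only [hχρ]
    rw [hks, hKcard, Nat.cast_sub hk, nsmul_eq_mul]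
    ring
  choose! k hkn hk using hfib
  have htotal : ∑ t ∈ s, (χ 1 - χ t) = ((e * ∑ H' ∈ O, k H' : ℕ) : ℂ) := by
    rw [← Finset.sum_fiberwise_of_maps_to (t := O)
      (g := fun t : W => fixedSpace (t : (V →ₗ[ℂ] V)ˣ))]
    · rw [Finset.sum_congr rfl hk, ← Finset.mul_sum]
      push_cast
      rfl
    · intro t ht
      rw [hs, Set.mem_toFinset] at ht
      simpa [hO] using ht.2
  set N : ℕ := e * ∑ H' ∈ O, k H' with hN
  obtain ⟨c, hc, hcs⟩ := aux_integral hn ρ hirr s (by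
    intro g t ht
    rw [hs, Set.mem_toFinset] at ht ⊢
    exact Cref_conj W H g t ht)
  have hcN : ((s.card : ℂ) - c) * n = N := by
    rw [← htotal, Finset.sum_sub_distrib, Finset.sum_const, hχ1]
    simp only [hχρ]
    rw [hcs, nsmul_eq_mul]
    ring
  have hint : IsIntegral ℤ ((s.card : ℂ) - c) :=
    (isIntegral_algebraMap (R := ℤ) (A := ℂ) (x := (s.card : ℤ)) |> fun h => by
      simpa using h : IsIntegral ℤ (s.card : ℂ)).sub hc
  have hq : ((s.card : ℂ) - c) = algebraMap ℚ ℂ ((N : ℚ) / n) := by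
    rw [eq_div_of_mul_eq hn0 hcN]
    simp
  rw [hq, isIntegral_algebraMap_iff (FaithfulSMul.algebraMap_injective ℚ ℂ),
    IsIntegrallyClosed.isIntegral_iff] at hint
  obtain ⟨z, hz⟩ := hint
  have hn0q : (n : ℚ) ≠ 0 := by exact_mod_cast hn.ne'
  have hzN : z * n = N := by
    have : (z : ℚ) * n = N := by
      have h : (z : ℚ) = (N : ℚ) / n := by simpa using hz
      rw [h, div_mul_cancel₀ _ hn0q]
    exact_mod_cast this
  have hz0 : 0 ≤ z := by
    by_contra hneg
    push Not at hneg
    have : z * n < 0 := mul_neg_of_neg_of_pos hneg (by exact_mod_cast hn)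
    omega
  lift z to ℕ using hz0
  have hzN' : z * n = N := by exact_mod_cast hzN
  refine ⟨z, ?_, ?_⟩
  · rw [hsum, htotal, hχ1, ← hzN']
    push_cast
    rfl
  · have hOcard : (orbitOf W H).ncard = O.card := Set.ncard_eq_toFinset_card _ hOfin
    rw [hOcard]
    have h1 : ∑ H' ∈ O, k H' ≤ O.card * n := by
      have := Finset.sum_le_card_nsmul O k n hkn
      simpa using this
    have h2 : z * n ≤ e * O.card * n := by
      rw [hzN', hN, mul_assoc]
      exact Nat.mul_le_mul_left _ h1
    exact Nat.le_of_mul_le_mul_right h2 hn
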